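/- Let D be an H-colored r-transitive digraph (r ≥ 2). For every l ≥ r−1 and every k ≥ 2, D has a (k,l,H)-kernel. -/

import Mathlib

/-!
Setting: `A : V → V → Prop` is the arc relation of a loopless digraph `D`,
`AH : VH → VH → Prop` is the arc relation of a digraph `H` (possibly with loops),
and `ρ : V → V → VH` colors each arc of `D` with a vertex of `H`
(`D` is an `H`-colored digraph).
-/

open scoped Classical

noncomputable section

variable {V VH : Type*}

/-- `x 0, x 1, …, x n` is a walk of length `n` in the digraph with arc relation `A`. -/
def IsWalk (A : V → V → Prop) (n : ℕ) (x : ℕ → V) : Prop :=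
  ∀ i < n, A (x i) (x (i + 1))

/-- A (directed) path of length `n`: a walk whose `n + 1` vertices are pairwise distinct. -/
def IsPath (A : V → V → Prop) (n : ℕ) (x : ℕ → V) : Prop :=
  IsWalk A n x ∧ ∀ i ≤ n, ∀ j ≤ n, x i = x j → i = j

/-- A (directed) cycle of length `n`: a nontrivial closed walk whose first `n` vertices are
pairwise distinct. -/
def IsCycle (A : V → V → Prop) (n : ℕ) (x : ℕ → V) : Prop :=
  IsWalk A n x ∧ x n = x 0 ∧ 1 ≤ n ∧ ∀ i < n, ∀ j < n, x i = x j → i = j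

/-- The set `O_H(W)` of obstructions of an open walk `W = (x 0, …, x n)`: the indices
`i ∈ {1, …, n-1}` such that `(ρ(x_{i-1}, x_i), ρ(x_i, x_{i+1}))` is not an arc of `H`. -/
def obstrOpen (AH : VH → VH → Prop) (ρ : V → V → VH) (n : ℕ) (x : ℕ → V) : Finset ℕ :=
  (Finset.Ico 1 n).filter fun i => ¬ AH (ρ (x (i - 1)) (x i)) (ρ (x i) (x (i + 1)))

/-- The set `O_H(W)` of obstructions of a closed walk `W = (x 0, …, x n)` (`x n = x 0`):
the indices `i ∈ {0, …, n-1}`, taken modulo `n`, such that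
`(ρ(x_{i-1}, x_i), ρ(x_i, x_{i+1}))` is not an arc of `H`. -/
def obstrClosed (AH : VH → VH → Prop) (ρ : V → V → VH) (n : ℕ) (x : ℕ → V) : Finset ℕ :=
  (Finset.range n).filter fun i =>
    ¬ AH (ρ (x (if i = 0 then n - 1 else i - 1)) (x i)) (ρ (x i) (x (i + 1)))

/-- The `H`-length of an open walk: `|O_H(W)| + 1`. -/
def HLenOpen (AH : VH → VH → Prop) (ρ : V → V → VH) (n : ℕ) (x : ℕ → V) : ℕ :=
  (obstrOpen AH ρ n x).card + 1

/-- The `H`-length of a closed walk: `|O_H(W)|`. -/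
def HLenClosed (AH : VH → VH → Prop) (ρ : V → V → VH) (n : ℕ) (x : ℕ → V) : ℕ :=
  (obstrClosed AH ρ n x).card

/-- `(u,v)` is an arc of the `(l,H)`-closure `C_H^l(D)` iff there exists a `uv`-path in `D`
with `H`-length at most `l`. -/
def ClosureAdj (A : V → V → Prop) (AH : VH → VH → Prop) (ρ : V → V → VH) (l : ℕ)
    (u v : V) : Prop :=
  ∃ n x, 1 ≤ n ∧ IsPath A n x ∧ x 0 = u ∧ x n = v ∧ HLenOpen AH ρ n x ≤ l

/-- `S` is `(k,H)`-independent: every path between two different vertices of `S`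
has `H`-length at least `k`. -/
def KHIndependent (A : V → V → Prop) (AH : VH → VH → Prop) (ρ : V → V → VH)
    (k : ℕ) (S : Set V) : Prop :=
  ∀ u ∈ S, ∀ v ∈ S, u ≠ v →
    ∀ n x, IsPath A n x → x 0 = u → x n = v → k ≤ HLenOpen AH ρ n x

/-- `S` is `(l,H)`-absorbent: from every vertex outside `S` there exists a path to some
vertex of `S` with `H`-length at most `l`. -/
def LHAbsorbent (A : V → V → Prop) (AH : VH → VH → Prop) (ρ : V → V → VH)
    (l : ℕ) (S : Set V) : Prop :=
  ∀ v ∉ S, ∃ w ∈ S, ∃ n x, IsPath A n x ∧ x 0 = v ∧ x n = w ∧ HLenOpen AH ρ n x ≤ l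

/-- A `(k,H)`-kernel: a `(k,H)`-independent and `(k-1,H)`-absorbent set of vertices. -/
def IsKHKernel (A : V → V → Prop) (AH : VH → VH → Prop) (ρ : V → V → VH)
    (k : ℕ) (S : Set V) : Prop :=
  KHIndependent A AH ρ k S ∧ LHAbsorbent A AH ρ (k - 1) S

/-- A kernel of a digraph: an independent and absorbent set of vertices. -/
def IsKernel (A : V → V → Prop) (S : Set V) : Prop :=
  (∀ u ∈ S, ∀ v ∈ S, u ≠ v → ¬ A u v) ∧ ∀ u ∉ S, ∃ v ∈ S, A u v

/-- A digraph is `r`-transitive if the existence of a `uv`-path of length `r` implies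
that `(u,v)` is an arc. -/
def RTransitive (A : V → V → Prop) (r : ℕ) : Prop :=
  ∀ x : ℕ → V, IsPath A r x → A (x 0) (x r)

/-- Reachability is witnessed by a walk. -/
theorem exists_isWalk_of_reflTransGen {A : V → V → Prop} {u v : V}
    (h : Relation.ReflTransGen A u v) : ∃ n x, IsWalk A n x ∧ x 0 = u ∧ x n = v := by
  induction h with
  | refl => exact ⟨0, fun _ => u, fun i hi => absurd hi (Nat.not_lt_zero i), rfl, rfl⟩
  | @tail b c _ hbc ih =>
    obtain ⟨n, x, hw, h0, hn⟩ := ih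
    refine ⟨n + 1, fun t => if t ≤ n then x t else c, fun i hi => ?_, by simpa using h0, by simp⟩
    rcases Nat.lt_succ_iff_lt_or_eq.mp hi with h | rfl
    · simpa [h.le, Nat.succ_le_of_lt h] using hw i h
    · simpa [hn] using hbc

/-- Every walk yields reachability. -/
theorem IsWalk.reflTransGen {A : V → V → Prop} {n : ℕ} {x : ℕ → V} (h : IsWalk A n x) :
    Relation.ReflTransGen A (x 0) (x n) := by
  induction n with
  | zero => exact .refl
  | succ n ih => exact (ih fun i hi => h i (by omega)).tail (h n (by omega))

/-- A walk that visits a vertex twice can be shortened by cutting out the closed part. -/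
theorem IsWalk.cut_of_eq {A : V → V → Prop} {n i j : ℕ} {x : ℕ → V} (h : IsWalk A n x)
    (hij : i < j) (hj : j ≤ n) (he : x i = x j) :
    ∃ y, IsWalk A (n - (j - i)) y ∧ y 0 = x 0 ∧ y (n - (j - i)) = x n := by
  refine ⟨fun t => if t ≤ i then x t else x (t + (j - i)), fun t ht => ?_, by simp, ?_⟩
  · rcases lt_trichotomy t i with hti | rfl | hti
    · simpa [hti.le, Nat.succ_le_of_lt hti] using h t (by omega)
    · have e : t + 1 + (j - t) = j + 1 := by omega
      simpa [e, he] using h j (by omega)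
    · have e : t + 1 + (j - i) = t + (j - i) + 1 := by omega
      have h1 : ¬ t ≤ i := by omega
      have h2 : ¬ t + 1 ≤ i := by omega
      simpa only [h1, h2, if_false, e] using h (t + (j - i)) (by omega)
  · by_cases hn : n - (j - i) ≤ i
    · have e : n - (j - i) = i := by omega
      obtain rfl : j = n := by omega
      simp only [e, le_refl, if_true, he]
    · have e : n - (j - i) + (j - i) = n := by omega
      simp only [hn, if_false, e]

/-- An arc from the first vertex of a walk to a later vertex shortens the walk. -/
theorem IsWalk.shortcut {A : V → V → Prop} {n r : ℕ} {x : ℕ → V} (h : IsWalk A n x)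
    (hr : 1 ≤ r) (hrn : r ≤ n) (ha : A (x 0) (x r)) :
    ∃ y, IsWalk A (n - r + 1) y ∧ y 0 = x 0 ∧ y (n - r + 1) = x n := by
  refine ⟨fun t => if t = 0 then x 0 else x (t + r - 1), fun t ht => ?_, by simp, ?_⟩
  · rcases Nat.eq_zero_or_pos t with rfl | ht0
    · have e : 0 + 1 + r - 1 = r := by omega
      simpa [e] using ha
    · have e : t + 1 + r - 1 = t + r - 1 + 1 := by omega
      simpa only [ht0.ne', Nat.succ_ne_zero, if_false, e] using h (t + r - 1) (by omega)
  · have e : n - r + 1 + r - 1 = n := by omega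
    simp only [Nat.succ_ne_zero, if_false, e]

/-- In an `r`-transitive digraph, reachability is witnessed by a path of length less than `r`. -/
theorem RTransitive.exists_isPath_lt {A : V → V → Prop} {r : ℕ} (htr : RTransitive A r)
    (hr : 2 ≤ r) {u v : V} (h : Relation.ReflTransGen A u v) :
    ∃ n x, n < r ∧ IsPath A n x ∧ x 0 = u ∧ x n = v := by
  have hex := exists_isWalk_of_reflTransGen h
  obtain ⟨x, hw, h0, hn⟩ := Nat.find_spec hex
  have hmin : ∀ m < Nat.find hex, ∀ y, IsWalk A m y → y 0 = u → y m ≠ v :=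
    fun m hm y hy hy0 hym => Nat.find_min hex hm ⟨y, hy, hy0, hym⟩
  generalize Nat.find hex = n at *
  have hne : ∀ i j, i < j → j ≤ n → x i ≠ x j := by
    intro i j hij hj he
    obtain ⟨y, hy, hy0, hyn⟩ := hw.cut_of_eq hij hj he
    exact hmin _ (by omega) y hy (hy0.trans h0) (hyn.trans hn)
  have hinj : ∀ i ≤ n, ∀ j ≤ n, x i = x j → i = j := by
    intro i hi j hj he
    rcases lt_trichotomy i j with hij | hij | hij
    · exact absurd he (hne i j hij hj)
    · exact hij
    · exact absurd he.symm (hne j i hij hi)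
  refine ⟨n, x, ?_, ⟨hw, hinj⟩, h0, hn⟩
  by_contra! hrn
  have ha : A (x 0) (x r) := htr x ⟨fun i hi => hw i (by omega),
    fun i hi j hj => hinj i (by omega) j (by omega)⟩
  obtain ⟨y, hy, hy0, hyn⟩ := hw.shortcut (by omega) hrn ha
  exact hmin _ (by omega) y hy (hy0.trans h0) (hyn.trans hn)

/-- The `H`-length of an open walk is at most its length, or one if it is trivial. -/
theorem HLenOpen_le (AH : VH → VH → Prop) (ρ : V → V → VH) (n : ℕ) (x : ℕ → V) :
    HLenOpen AH ρ n x ≤ max n 1 := by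
  have h : (obstrOpen AH ρ n x).card ≤ (Finset.Ico 1 n).card := Finset.card_filter_le _ _
  rw [Nat.card_Ico] at h
  unfold HLenOpen
  omega

/-- For every relation on a finite type there is a set that every element reaches, and whose
distinct elements do not reach each other. -/
theorem exists_reflTransGen_kernel [Finite V] (A : V → V → Prop) :
    ∃ S : Set V, (∀ u ∈ S, ∀ v ∈ S, Relation.ReflTransGen A u v → u = v) ∧
      ∀ v, ∃ w ∈ S, Relation.ReflTransGen A v w := by
  let _ : Preorder V :=
    { le := Relation.ReflTransGen A
      le_refl := fun _ => .refl
      le_trans := fun _ _ _ => .trans }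
  let c : V → V := fun v => ofAntisymmetrization (· ≤ ·) (toAntisymmetrization (· ≤ ·) v)
  have hc : ∀ v, AntisymmRel (· ≤ ·) (c v) v := fun v =>
    Quotient.mk_out (s := AntisymmRel.setoid V (· ≤ ·)) v
  refine ⟨{v | IsMax v ∧ c v = v}, ?_, fun v => ?_⟩
  · rintro u ⟨hu, hcu⟩ v ⟨-, hcv⟩ huv
    have e : c u = c v := congrArg (ofAntisymmetrization (· ≤ ·))
      (Quotient.sound (s := AntisymmRel.setoid V (· ≤ ·)) ⟨huv, hu huv⟩)
    exact hcu.symm.trans (e.trans hcv)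
  · obtain ⟨w, hvw, hw⟩ := Finite.exists_le_maximal (p := fun _ : V => True) (a := v) trivial
    have hwmax : IsMax w := fun b hb => hw.2 trivial hb
    refine ⟨c w, ⟨hwmax.mono (hc w).2, ?_⟩, le_trans hvw (hc w).2⟩
    exact congrArg (ofAntisymmetrization (· ≤ ·))
      (Quotient.sound (s := AntisymmRel.setoid V (· ≤ ·)) (hc w))

/-- Every `H`-colored `r`-transitive digraph (`r ≥ 2`) has a `(k,l,H)`-kernel for every
`l ≥ r - 1` and every `k ≥ 2`. -/
theorem rTransitive_has_klHKernel [Fintype V]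
    (A : V → V → Prop) (hloopless : ∀ v : V, ¬ A v v)
    (r : ℕ) (hr : 2 ≤ r) (htr : RTransitive A r)
    (AH : VH → VH → Prop) (ρ : V → V → VH)
    (l k : ℕ) (hl : r - 1 ≤ l) (hk : 2 ≤ k) :
    ∃ S : Set V, KHIndependent A AH ρ k S ∧ LHAbsorbent A AH ρ l S := by
  obtain ⟨S, hind, habs⟩ := exists_reflTransGen_kernel A
  refine ⟨S, ?_, fun v _ => ?_⟩
  · rintro u hu v hv huv n x hx rfl rfl
    exact absurd (hind _ hu _ hv hx.1.reflTransGen) huv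
  · obtain ⟨w, hw, hvw⟩ := habs v
    obtain ⟨n, x, hn, hx, h0, hxn⟩ := htr.exists_isPath_lt hr hvw
    have hlen := HLenOpen_le AH ρ n x
    exact ⟨w, hw, n, x, hx, h0, hxn, by omega⟩
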